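/- arXiv:2301.04625 — 4 statements merged into one kernel-verified Lean document; each statement's English description precedes it below -/
import Mathlib

section
/- Suppose S is positive definite, Σₓ is positive definite, and ω > 0. Then for every λ > 0 with λ·σ_1(βᵀβ) ≤ ω, where σ_1(βᵀβ) is the largest eigenvalue of βᵀβ, the risk satisfies R(λ) < ω·tr(Σₓ S⁻¹). -/
open Matrix

/-- The prediction risk of the enhanced response envelope estimator (known envelope). -/
noncomputable def enhancedRisk {p r : ℕ} (S Sx : Matrix (Fin p) (Fin p) ℝ)
    (β : Matrix (Fin r) (Fin p) ℝ) (ω lam : ℝ) : ℝ :=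
  lam ^ 2 * (β * (S + lam • 1)⁻¹ * Sx * (S + lam • 1)⁻¹ * βᵀ).trace
    + ω * (Sx * S * ((S + lam • 1)⁻¹ * (S + lam • 1)⁻¹)).trace

/-- The `i`-th largest eigenvalue of a square real matrix, defined as the `i`-th element
of the list of roots of its characteristic polynomial sorted in decreasing order
(with default value `0`). For symmetric matrices this is the usual `i`-th largest
eigenvalue. -/
noncomputable def ithLargestEigenvalue {p : ℕ} (M : Matrix (Fin p) (Fin p) ℝ)
    (i : Fin p) : ℝ :=
  (M.charpoly.roots.sort (· ≥ ·)).getD i 0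


lemma aux_spec {p : ℕ} {A : Matrix (Fin p) (Fin p) ℝ} (hA : A.IsHermitian) :
    A = (hA.eigenvectorUnitary : Matrix (Fin p) (Fin p) ℝ) * diagonal hA.eigenvalues *
      (hA.eigenvectorUnitary : Matrix (Fin p) (Fin p) ℝ)ᴴ := by
  have h := hA.spectral_theorem
  rw [Unitary.conjStarAlgAut_apply] at h
  exact h

lemma aux_trace_pos {p : ℕ} (hp : 1 ≤ p) {A N : Matrix (Fin p) (Fin p) ℝ} (hA : A.PosDef)
    (hN : N.PosDef) : 0 < (A * N).trace := by
  have : Nonempty (Fin p) := ⟨⟨0, hp⟩⟩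
  set U : Matrix (Fin p) (Fin p) ℝ := (hA.1.eigenvectorUnitary : Matrix (Fin p) (Fin p) ℝ) with hU
  have hs : A = U * diagonal hA.1.eigenvalues * Uᴴ := aux_spec hA.1
  have hUU : Uᴴ * U = 1 := Unitary.coe_star_mul_self hA.1.eigenvectorUnitary
  have hUu : IsUnit U := IsUnit.of_mul_eq_one_right _ hUU
  have hM : (Uᴴ * N * U).PosDef :=
    hN.conjTranspose_mul_mul_same (Matrix.mulVec_injective_iff_isUnit.2 hUu)
  have ht : (A * N).trace = (diagonal hA.1.eigenvalues * (Uᴴ * N * U)).trace := by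
    conv_lhs => rw [hs]
    rw [Matrix.mul_assoc, Matrix.mul_assoc, Matrix.trace_mul_comm]
    simp only [Matrix.mul_assoc]
  rw [ht, Matrix.trace]
  refine Finset.sum_pos (fun i _ => ?_) Finset.univ_nonempty
  rw [diag_apply, diagonal_mul]
  exact mul_pos (hA.eigenvalues_pos i) hM.diag_pos

lemma aux_le {p : ℕ} (hp : 1 ≤ p) {G : Matrix (Fin p) (Fin p) ℝ} (hG : G.IsHermitian)
    (i : Fin p) : hG.eigenvalues i ≤ ithLargestEigenvalue G ⟨0, hp⟩ := by
  unfold ithLargestEigenvalue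
  have hmem : hG.eigenvalues i ∈ G.charpoly.roots.sort (· ≥ ·) := by
    rw [Multiset.mem_sort, hG.roots_charpoly_eq_eigenvalues]
    exact Multiset.mem_map.2 ⟨i, Finset.mem_univ i, rfl⟩
  have hpw := Multiset.pairwise_sort G.charpoly.roots (· ≥ ·)
  revert hmem hpw
  generalize G.charpoly.roots.sort (· ≥ ·) = l
  intro hmem hpw
  cases l with
  | nil => simp at hmem
  | cons a t =>
    rcases List.mem_cons.1 hmem with h | h
    · simp [h]
    · simpa using (List.pairwise_cons.1 hpw).1 _ h

lemma aux_psd {p : ℕ} (hp : 1 ≤ p) {G : Matrix (Fin p) (Fin p) ℝ} (hG : G.IsHermitian)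
    {ω lam : ℝ} (hlam : 0 < lam) (h : lam * ithLargestEigenvalue G ⟨0, hp⟩ ≤ ω) :
    (ω • (1 : Matrix (Fin p) (Fin p) ℝ) - lam • G).PosSemidef := by
  set U : Matrix (Fin p) (Fin p) ℝ := (hG.eigenvectorUnitary : Matrix (Fin p) (Fin p) ℝ) with hU
  have hs : G = U * diagonal hG.eigenvalues * Uᴴ := aux_spec hG
  have hUU : U * Uᴴ = 1 := Unitary.coe_mul_star_self hG.eigenvectorUnitary
  have hd : (diagonal (fun i => ω - lam * hG.eigenvalues i)).PosSemidef :=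
    PosSemidef.diagonal (fun i => by
      have := mul_le_mul_of_nonneg_left (aux_le hp hG i) hlam.le
      simp only [Pi.zero_apply]; linarith)
  have he : diagonal (fun i => ω - lam * hG.eigenvalues i)
      = ω • (1 : Matrix (Fin p) (Fin p) ℝ) - lam • diagonal hG.eigenvalues := by
    ext i j
    by_cases hij : i = j
    · subst hij; simp
    · simp [hij]
  have := hd.mul_mul_conjTranspose_same U
  rw [he, Matrix.mul_sub, Matrix.sub_mul] at this
  simp only [Matrix.mul_smul, Matrix.smul_mul, Matrix.mul_one, hUU] at this
  rwa [← hs] at this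

theorem enhancedRisk_lt_varianceTerm
    (p r : ℕ) (hp : 1 ≤ p) (hr : 1 ≤ r)
    (S Sx : Matrix (Fin p) (Fin p) ℝ)
    (hS_psd : S.PosSemidef) (hSx_psd : Sx.PosSemidef)
    (hS : S.PosDef) (hSx : Sx.PosDef)
    (β : Matrix (Fin r) (Fin p) ℝ)
    (ω : ℝ) (hω : 0 < ω)
    (lam : ℝ) (hlam : 0 < lam)
    (hlam' : lam * ithLargestEigenvalue (βᵀ * β) ⟨0, hp⟩ ≤ ω) :
    enhancedRisk S Sx β ω lam < ω * (Sx * S⁻¹).trace := by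
  have hA : (S + lam • (1 : Matrix (Fin p) (Fin p) ℝ)).PosDef := hS.add (PosDef.one.smul hlam)
  have hG : (βᵀ * β).IsHermitian := by
    simpa using (posSemidef_conjTranspose_mul_self β).1
  have hP := aux_psd hp hG hlam hlam'
  unfold enhancedRisk
  set T := S + lam • (1 : Matrix (Fin p) (Fin p) ℝ) with hT
  set A := T⁻¹ with hAdef
  have hTu : IsUnit T.det := (Matrix.isUnit_iff_isUnit_det _).1 hA.isUnit
  have hSu : IsUnit S.det := (Matrix.isUnit_iff_isUnit_det _).1 hS.isUnit
  have hTA : T * A = 1 := Matrix.mul_nonsing_inv _ hTu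
  have hAT : A * T = 1 := Matrix.nonsing_inv_mul _ hTu
  have hSS : S * S⁻¹ = 1 := Matrix.mul_nonsing_inv _ hSu
  have hSS' : S⁻¹ * S = 1 := Matrix.nonsing_inv_mul _ hSu
  set M : Matrix (Fin p) (Fin p) ℝ :=
    lam • (ω • (1 : Matrix (Fin p) (Fin p) ℝ) - lam • (βᵀ * β))
      + ((ω * lam) • (1 : Matrix (Fin p) (Fin p) ℝ) + (ω * lam ^ 2) • S⁻¹) with hM
  have hMpd : M.PosDef := (PosDef.one.smul (by positivity)).add
    (hS.inv.smul (by positivity)) |>.posSemidef_add (hP.smul hlam.le)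
  have hAh : Aᴴ = A := hA.inv.1
  have hAMA : (A * M * A).PosDef := by
    have := hMpd.conjTranspose_mul_mul_same (B := A)
      (Matrix.mulVec_injective_iff_isUnit.2 hA.inv.isUnit)
    rwa [hAh] at this
  have hpos := aux_trace_pos hp hSx hAMA
  have hM2 : M = ω • (T * S⁻¹ * T) - ω • S - lam ^ 2 • (βᵀ * β) := by
    have : T * S⁻¹ * T = S + (2 * lam) • (1 : Matrix (Fin p) (Fin p) ℝ) + lam ^ 2 • S⁻¹ := by
      rw [hT]
      simp only [Matrix.add_mul, Matrix.mul_add, Matrix.smul_mul, Matrix.mul_smul, Matrix.one_mul,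
        Matrix.mul_one, hSS, hSS']
      module
    rw [this, hM]
    module
  have hAS : A * S = S * A := by
    have h1 : S = T - lam • (1 : Matrix (Fin p) (Fin p) ℝ) := by rw [hT]; abel
    rw [h1, Matrix.mul_sub, Matrix.sub_mul, hAT, hTA]
    simp
  have hkey : A * M * A = ω • S⁻¹ - ω • (S * (A * A)) - lam ^ 2 • (A * (βᵀ * β) * A) := by
    rw [hM2]
    have e1 : A * (T * S⁻¹ * T) * A = S⁻¹ := by
      calc A * (T * S⁻¹ * T) * A = (A * T) * S⁻¹ * (T * A) := by simp only [Matrix.mul_assoc]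
        _ = S⁻¹ := by rw [hAT, hTA]; simp
    simp only [Matrix.mul_sub, Matrix.sub_mul, Matrix.mul_smul, Matrix.smul_mul, e1]
    rw [hAS, Matrix.mul_assoc S A A]
  have htr : (β * A * Sx * A * βᵀ).trace = (Sx * (A * (βᵀ * β) * A)).trace := by
    rw [show β * A * Sx * A * βᵀ = (β * A) * (Sx * A * βᵀ) by simp only [Matrix.mul_assoc],
      Matrix.trace_mul_comm]
    simp only [Matrix.mul_assoc]
  rw [hkey] at hpos
  simp only [Matrix.mul_sub, Matrix.mul_smul, Matrix.trace_sub, Matrix.trace_smul,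
    smul_eq_mul] at hpos
  rw [htr, Matrix.mul_assoc Sx S (A * A)]
  linarith
end

section
/- For every γ ∈ (0,1) and every real z < 0, the Stieltjes transform of the Marchenko–Pastur law equals the closed form: ∫_{a_γ}^{b_γ} (1/(s−z))·√((b_γ−s)(s−a_γ))/(2πγs) ds = ((1−γ−z) − √((1−γ−z)² − 4γz))/(2γz). -/
open Real

lemma mp_integrable (a b w : ℝ) (hab : a < b) (hw : w < a) :
    IntervalIntegrable (fun s => √((b - s) * (s - a)) / (s - w)) MeasureTheory.volume a b := by
  apply ContinuousOn.intervalIntegrable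
  rw [Set.uIcc_of_le hab.le]
  apply ContinuousOn.div
  · fun_prop
  · fun_prop
  · intro s hs
    have := hs.1
    intro h
    linarith

lemma mp_core (a b w : ℝ) (hab : a < b) (hw : w < a) :
    ∫ s in a..b, √((b - s) * (s - a)) / (s - w)
      = π * ((a + b) / 2 - w - √((a - w) * (b - w))) := by
  obtain ⟨D, hD⟩ : ∃ D, D = √((a - w) * (b - w)) := ⟨_, rfl⟩
  have hpos : 0 < (a - w) * (b - w) := mul_pos (by linarith) (by linarith)
  have hD0 : 0 < D := hD ▸ Real.sqrt_pos.2 hpos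
  have hD2 : D ^ 2 = (a - w) * (b - w) := by rw [hD, Real.sq_sqrt hpos.le]
  obtain ⟨h, hh⟩ : ∃ h, h = (b - a) / 2 := ⟨_, rfl⟩
  obtain ⟨p, hp⟩ : ∃ p, p = (a + b) / 2 - w := ⟨_, rfl⟩
  have hh0 : 0 < h := by rw [hh]; linarith
  have hb : b = p + w + h := by rw [hh, hp]; ring
  have ha : a = p + w - h := by rw [hh, hp]; ring
  have hph : h < p := by linarith
  have hD2' : D ^ 2 = p ^ 2 - h ^ 2 := by rw [hD2, ha, hb]; ring
  have key := intervalIntegral.integral_eq_sub_of_hasDerivAt_of_le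
    (f := fun s => √((b - s) * (s - a)) + p * arcsin ((s - w - p) / h)
      - D * arcsin (p / h - D ^ 2 / h / (s - w)))
    (f' := fun s => √((b - s) * (s - a)) / (s - w)) hab.le ?_ ?_ (mp_integrable a b w hab hw)
  · rw [key, ← hD, ← hp]
    have e1 : (b - w - p) / h = 1 := by rw [hb]; field_simp; ring
    have e2 : (a - w - p) / h = -1 := by rw [ha]; field_simp; ring
    have e3 : p / h - D ^ 2 / h / (b - w) = 1 := by
      have : p + h ≠ 0 := by linarith
      rw [hD2', hb, show p + w + h - w = p + h by ring]; field_simp; ring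
    have e4 : p / h - D ^ 2 / h / (a - w) = -1 := by
      have : p - h ≠ 0 := by linarith
      rw [hD2', ha, show p + w - h - w = p - h by ring]; field_simp; ring
    simp only [e1, e2, e3, e4, arcsin_one, arcsin_neg_one, sub_self, zero_mul, mul_zero, sqrt_zero]
    ring
  · have : ∀ s ∈ Set.Icc a b, s - w ≠ 0 := fun s hs => by have := hs.1; linarith
    have h1 : ContinuousOn (fun s => p / h - D ^ 2 / h / (s - w)) (Set.Icc a b) :=
      continuousOn_const.sub (continuousOn_const.div (by fun_prop) this)
    have h2 := Real.continuous_arcsin.comp_continuousOn h1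
    have h3 : Continuous (fun s => √((b - s) * (s - a)) + p * arcsin ((s - w - p) / h)) := by
      have := Real.continuous_arcsin
      fun_prop
    exact h3.continuousOn.sub (continuousOn_const.mul h2)
  · intro s hs
    have hsa := hs.1
    have hsb := hs.2
    have hq : 0 < (b - s) * (s - a) := mul_pos (by linarith) (by linarith)
    obtain ⟨R, hR⟩ : ∃ R, R = √((b - s) * (s - a)) := ⟨_, rfl⟩
    have hR0 : 0 < R := hR ▸ Real.sqrt_pos.2 hq
    obtain ⟨t, ht⟩ : ∃ t, t = s - w := ⟨_, rfl⟩
    have ht0 : 0 < t := by linarith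
    have hR2 : R ^ 2 = h ^ 2 - (t - p) ^ 2 := by
      rw [hR, Real.sq_sqrt hq.le, ha, hb, ht]; ring
    have s1 : 1 - ((s - w - p) / h) ^ 2 = (R / h) ^ 2 := by
      rw [div_pow R, hR2, ← ht]; field_simp
    have s2 : 1 - (p / h - D ^ 2 / h / (s - w)) ^ 2 = (D * R / (h * t)) ^ 2 := by
      rw [div_pow (D * R), mul_pow, hR2, ← ht, hD2']; field_simp; ring
    have p1 : 0 < (R / h) ^ 2 := by positivity
    have p2 : 0 < (D * R / (h * t)) ^ 2 := by positivity
    have d0 : HasDerivAt (fun s => √((b - s) * (s - a)))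
        (((-1) * (s - a) + (b - s) * 1) / (2 * √((b - s) * (s - a)))) s :=
      HasDerivAt.sqrt (((hasDerivAt_id s).const_sub b).mul ((hasDerivAt_id s).sub_const a)) hq.ne'
    have d1 := (Real.hasDerivAt_arcsin (x := (s - w - p) / h)
      (by intro e; rw [e] at s1; linarith) (by intro e; rw [e] at s1; linarith)).comp s
      ((((hasDerivAt_id s).sub_const w).sub_const p).div_const h)
    have d2 := (Real.hasDerivAt_arcsin (x := p / h - D ^ 2 / h / (s - w))
      (by intro e; rw [e] at s2; linarith) (by intro e; rw [e] at s2; linarith)).comp s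
      (((hasDerivAt_const s (D ^ 2 / h)).div ((hasDerivAt_id s).sub_const w)
        (by simp only [id]; linarith)).const_sub (p / h))
    have d := (d0.add (d1.const_mul p)).sub (d2.const_mul D)
    refine HasDerivAt.congr_deriv d ?_
    rw [s1, s2, Real.sqrt_sq (by positivity), Real.sqrt_sq (by positivity), ← hR]
    simp only [id, ← ht]
    have e1 : s = t + w := by rw [ht]; ring
    have e2 : R / t = R ^ 2 / (R * t) := by field_simp
    rw [e2, hR2, e1, ha, hb]
    field_simp
    rw [hD2']
    ring

theorem marchenkoPastur_stieltjes_transform_closed_form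
    (γ : ℝ) (hγ : 0 < γ) (hγ1 : γ < 1) (z : ℝ) (hz : z < 0) :
    ∫ s in ((1 - Real.sqrt γ) ^ 2)..((1 + Real.sqrt γ) ^ 2),
        (1 / (s - z)) *
          (Real.sqrt (((1 + Real.sqrt γ) ^ 2 - s) * (s - (1 - Real.sqrt γ) ^ 2))
            / (2 * Real.pi * γ * s))
      = ((1 - γ - z) - Real.sqrt ((1 - γ - z) ^ 2 - 4 * γ * z)) / (2 * γ * z) := by
  have hg0 : 0 < √γ := Real.sqrt_pos.2 hγ
  have hg2 : √γ ^ 2 = γ := Real.sq_sqrt hγ.le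
  have hg1 : √γ < 1 := by nlinarith
  generalize √γ = g at *
  subst hg2
  have ha : 0 < (1 - g) ^ 2 := by have : 0 < 1 - g := by linarith
                                  positivity
  have hab : (1 - g) ^ 2 < (1 + g) ^ 2 := by nlinarith
  have c0 := mp_core _ _ 0 hab ha
  have cz := mp_core _ _ z hab (hz.trans ha)
  have i0 := mp_integrable _ _ 0 hab ha
  have iz := mp_integrable _ _ z hab (hz.trans ha)
  have e : ∫ s in ((1 - g) ^ 2)..((1 + g) ^ 2),
        (1 / (s - z)) * (√(((1 + g) ^ 2 - s) * (s - (1 - g) ^ 2)) / (2 * π * g ^ 2 * s))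
      = ∫ s in ((1 - g) ^ 2)..((1 + g) ^ 2), (1 / (2 * π * g ^ 2 * z)) *
        (√(((1 + g) ^ 2 - s) * (s - (1 - g) ^ 2)) / (s - z)
          - √(((1 + g) ^ 2 - s) * (s - (1 - g) ^ 2)) / (s - 0)) := by
    apply intervalIntegral.integral_congr
    intro s hs
    rw [Set.uIcc_of_le hab.le] at hs
    have hs0 : 0 < s := ha.trans_le hs.1
    have hsz : s - z ≠ 0 := by linarith
    have := hz.ne
    have := Real.pi_pos.ne'
    simp only [sub_zero]
    field_simp
    ring
  rw [e, intervalIntegral.integral_const_mul, intervalIntegral.integral_sub iz i0, c0, cz]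
  have r0 : √(((1 - g) ^ 2 - 0) * ((1 + g) ^ 2 - 0)) = 1 - g ^ 2 := by
    rw [show ((1 - g) ^ 2 - 0) * ((1 + g) ^ 2 - 0) = (1 - g ^ 2) ^ 2 by ring,
      Real.sqrt_sq (by linarith)]
  have rz : ((1 - g) ^ 2 - z) * ((1 + g) ^ 2 - z) = (1 - g ^ 2 - z) ^ 2 - 4 * g ^ 2 * z := by ring
  rw [r0, rz]
  have := hz.ne
  have := Real.pi_pos.ne'
  field_simp
  ring
end

section
/- For every γ > 1 and every real z < 0, the Stieltjes transform of the Marchenko–Pastur law (including its point mass 1−1/γ at 0) equals the closed form: (1−1/γ)·(1/(−z)) + ∫_{a_γ}^{b_γ} (1/(s−z))·√((b_γ−s)(s−a_γ))/(2πγs) ds = ((1−γ−z) − √((1−γ−z)² − 4γz))/(2γz). -/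
open Real

lemma mp_aux (c h w : ℝ) (hh : 0 < h) (hw : w < c - h) :
    ∫ s in (c - h)..(c + h), Real.sqrt ((c + h - s) * (s - (c - h))) / (s - w)
      = Real.pi * (c - w - Real.sqrt ((c - h - w) * (c + h - w))) := by
  have hDpos : 0 < (c - h - w) * (c + h - w) := mul_pos (by linarith) (by linarith)
  obtain ⟨q, hq⟩ : ∃ q, q = Real.sqrt ((c - h - w) * (c + h - w)) := ⟨_, rfl⟩
  have hqpos : 0 < q := hq ▸ Real.sqrt_pos.2 hDpos
  have hqsq : q ^ 2 = (c - h - w) * (c + h - w) := by rw [hq, Real.sq_sqrt hDpos.le]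
  rw [← hq]
  have hle : c - h ≤ c + h := by linarith
  have key := intervalIntegral.integral_eq_sub_of_hasDerivAt_of_le
    (f := fun s => Real.sqrt ((c + h - s) * (s - (c - h))) + (c - w) * Real.arcsin ((s - c) / h)
      - q * Real.arcsin ((c - w) / h - q ^ 2 / h / (s - w)))
    (f' := fun s => Real.sqrt ((c + h - s) * (s - (c - h))) / (s - w)) hle ?_ ?_ ?_
  · rw [key]
    have e1 : (c + h - c) / h = 1 := by field_simp; ring
    have e2 : (c - h - c) / h = -1 := by field_simp; ring
    have n1 : c + h - w ≠ 0 := by linarith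
    have n2 : c - h - w ≠ 0 := by linarith
    have e3 : (c - w) / h - q ^ 2 / h / (c + h - w) = 1 := by
      rw [hqsq]; field_simp; ring
    have e4 : (c - w) / h - q ^ 2 / h / (c - h - w) = -1 := by
      rw [hqsq]; field_simp; ring
    simp only [e1, e2, e3, e4, Real.arcsin_one, Real.arcsin_neg_one, sub_self, mul_zero, zero_mul,
      Real.sqrt_zero]
    ring
  · have hne : ∀ s ∈ Set.Icc (c - h) (c + h), s - w ≠ 0 := fun s hs => by
      have := hs.1; linarith
    refine ContinuousOn.sub (by fun_prop) (continuousOn_const.mul ?_)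
    refine Real.continuous_arcsin.comp_continuousOn ?_
    exact continuousOn_const.sub (continuousOn_const.div (by fun_prop) hne)
  · intro s hs
    obtain ⟨hs1, hs2⟩ := hs
    have ht : 0 < s - w := by linarith
    have hR : 0 < (c + h - s) * (s - (c - h)) := mul_pos (by linarith) (by linarith)
    obtain ⟨r, hr⟩ : ∃ r, r = Real.sqrt ((c + h - s) * (s - (c - h))) := ⟨_, rfl⟩
    have hrpos : 0 < r := hr ▸ Real.sqrt_pos.2 hR
    have hrsq : r ^ 2 = (c + h - s) * (s - (c - h)) := by rw [hr, Real.sq_sqrt hR.le]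
    have v1 : 1 - ((s - c) / h) ^ 2 = (r / h) ^ 2 := by
      rw [div_pow r, hrsq]; field_simp; ring
    have v2 : 1 - ((c - w) / h - q ^ 2 / h / (s - w)) ^ 2 = (q * r / (h * (s - w))) ^ 2 := by
      rw [div_pow (q * r), mul_pow, hrsq, hqsq]; field_simp; ring
    have p1 : 0 < r / h := by positivity
    have p2 : 0 < q * r / (h * (s - w)) := by positivity
    have b1 : (s - c) / h ≠ -1 ∧ (s - c) / h ≠ 1 := by
      constructor <;> intro hx <;> rw [hx] at v1 <;> nlinarith [pow_pos p1 2]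
    have b2 : (c - w) / h - q ^ 2 / h / (s - w) ≠ -1 ∧ (c - w) / h - q ^ 2 / h / (s - w) ≠ 1 := by
      constructor <;> intro hx <;> rw [hx] at v2 <;> nlinarith [pow_pos p2 2]
    have d1 : HasDerivAt (fun s => (c + h - s) * (s - (c - h)))
        ((-1) * (s - (c - h)) + (c + h - s) * 1) s :=
      ((hasDerivAt_id s).const_sub (c + h)).mul ((hasDerivAt_id s).sub_const (c - h))
    have d2 : HasDerivAt (fun s => (s - c) / h) (1 / h) s :=
      ((hasDerivAt_id s).sub_const c).div_const h
    have d3 : HasDerivAt (fun s => (c - w) / h - q ^ 2 / h / (s - w))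
        (-((0 * (s - w) - q ^ 2 / h * 1) / (s - w) ^ 2)) s :=
      ((hasDerivAt_const s (q ^ 2 / h)).div ((hasDerivAt_id s).sub_const w) ht.ne').const_sub _
    have D := ((d1.sqrt hR.ne').add
      (((Real.hasDerivAt_arcsin b1.1 b1.2).comp s d2).const_mul (c - w))).sub
      (((Real.hasDerivAt_arcsin b2.1 b2.2).comp s d3).const_mul q)
    rw [v1, v2, Real.sqrt_sq p1.le, Real.sqrt_sq p2.le, ← hr] at D
    show HasDerivAt _ (Real.sqrt ((c + h - s) * (s - (c - h))) / (s - w)) s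
    rw [← hr]
    refine D.congr_deriv ?_
    field_simp
    rw [hrsq, hqsq]
    ring
  · refine ContinuousOn.intervalIntegrable ?_
    rw [Set.uIcc_of_le hle]
    exact ContinuousOn.div (by fun_prop) (by fun_prop) (fun s hs => by have := hs.1; linarith)

theorem marchenkoPastur_stieltjes_transform_closed_form_gt_one
    (γ : ℝ) (hγ : 1 < γ) (z : ℝ) (hz : z < 0) :
    (1 - 1 / γ) * (1 / (-z)) +
      ∫ s in ((1 - Real.sqrt γ) ^ 2)..((1 + Real.sqrt γ) ^ 2),
        (1 / (s - z)) *
          (Real.sqrt (((1 + Real.sqrt γ) ^ 2 - s) * (s - (1 - Real.sqrt γ) ^ 2))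
            / (2 * Real.pi * γ * s))
      = ((1 - γ - z) - Real.sqrt ((1 - γ - z) ^ 2 - 4 * γ * z)) / (2 * γ * z) := by
  have hg0 : 0 < γ := by linarith
  have hsq : Real.sqrt γ ^ 2 = γ := Real.sq_sqrt hg0.le
  have hg : 0 < Real.sqrt γ := Real.sqrt_pos.2 hg0
  have hg1 : 1 < Real.sqrt γ := by nlinarith
  have ea : (1 - Real.sqrt γ) ^ 2 = 1 + γ - 2 * Real.sqrt γ := by linear_combination hsq
  have eb : (1 + Real.sqrt γ) ^ 2 = 1 + γ + 2 * Real.sqrt γ := by linear_combination hsq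
  have hapos : 0 < 1 + γ - 2 * Real.sqrt γ := by
    nlinarith
  rw [ea, eb]
  have I1 := mp_aux (1 + γ) (2 * Real.sqrt γ) z (by linarith) (by linarith)
  have I0 := mp_aux (1 + γ) (2 * Real.sqrt γ) 0 (by linarith) (by linarith)
  have s1 : (1 + γ - 2 * Real.sqrt γ - z) * (1 + γ + 2 * Real.sqrt γ - z)
      = (1 - γ - z) ^ 2 - 4 * γ * z := by linear_combination (-4) * hsq
  have s0 : (1 + γ - 2 * Real.sqrt γ - 0) * (1 + γ + 2 * Real.sqrt γ - 0)
      = (γ - 1) ^ 2 := by linear_combination (-4) * hsq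
  rw [s1] at I1
  rw [s0, Real.sqrt_sq (by linarith)] at I0
  have hle : 1 + γ - 2 * Real.sqrt γ ≤ 1 + γ + 2 * Real.sqrt γ := by linarith
  have hint : ∀ w ≤ (0:ℝ), IntervalIntegrable (fun s => Real.sqrt ((1 + γ + 2 * Real.sqrt γ - s) *
      (s - (1 + γ - 2 * Real.sqrt γ))) / (s - w)) MeasureTheory.volume
      (1 + γ - 2 * Real.sqrt γ) (1 + γ + 2 * Real.sqrt γ) := by
    intro w hw
    refine ContinuousOn.intervalIntegrable ?_
    rw [Set.uIcc_of_le hle]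
    exact ContinuousOn.div (by fun_prop) (by fun_prop) (fun s hs => by have := hs.1; linarith)
  have hpi := Real.pi_pos
  have hcongr : ∫ s in (1 + γ - 2 * Real.sqrt γ)..(1 + γ + 2 * Real.sqrt γ),
        (1 / (s - z)) *
          (Real.sqrt ((1 + γ + 2 * Real.sqrt γ - s) * (s - (1 + γ - 2 * Real.sqrt γ)))
            / (2 * Real.pi * γ * s))
      = ∫ s in (1 + γ - 2 * Real.sqrt γ)..(1 + γ + 2 * Real.sqrt γ),
        (1 / (2 * Real.pi * γ * z)) *
        (Real.sqrt ((1 + γ + 2 * Real.sqrt γ - s) * (s - (1 + γ - 2 * Real.sqrt γ))) / (s - z)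
        - Real.sqrt ((1 + γ + 2 * Real.sqrt γ - s) * (s - (1 + γ - 2 * Real.sqrt γ))) / (s - 0)) := by
    refine intervalIntegral.integral_congr ?_
    intro s hs
    rw [Set.uIcc_of_le hle] at hs
    have h1 : 0 < s := by linarith [hs.1]
    have h2 : s - z ≠ 0 := by linarith
    have h3 : z ≠ 0 := hz.ne
    simp only [sub_zero]
    generalize Real.sqrt ((1 + γ + 2 * Real.sqrt γ - s) * (s - (1 + γ - 2 * Real.sqrt γ))) = r
    field_simp
    ring
  rw [hcongr, intervalIntegral.integral_const_mul,
    intervalIntegral.integral_sub (hint z hz.le) (hint 0 le_rfl), I1, I0]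
  have h3 : z ≠ 0 := hz.ne
  generalize Real.sqrt ((1 - γ - z) ^ 2 - 4 * γ * z) = r
  field_simp
  ring
end

section
/- For every γ ∈ (0,1) and every λ > 0, the closed-form Stieltjes transform evaluated at −λ is strictly smaller than the value at 0: ((1−γ+λ) − √((1−γ+λ)² + 4γλ))/(−2γλ) < 1/(1−γ); that is, m(−λ) < 1/(1−γ). (This shows the gap between the limiting prediction risks of the envelope and the enhanced response envelope is positive for all 0 < γ < 1.) -/
theorem stieltjes_gap_positive
    (γ : ℝ) (hγ : 0 < γ) (hγ1 : γ < 1) (lam : ℝ) (hlam : 0 < lam) :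
    ((1 - γ + lam) - Real.sqrt ((1 - γ + lam) ^ 2 + 4 * γ * lam)) / (-(2 * γ * lam))
      < 1 / (1 - γ) := by
  have hd : 0 < 1 - γ := by linarith
  have hp : 0 < 2 * γ * lam := by positivity
  obtain ⟨t, ht⟩ : ∃ t, t = 2 * γ * lam / (1 - γ) := ⟨_, rfl⟩
  have htp : 0 < t := by rw [ht]; positivity
  have htd : t * (1 - γ) = 2 * γ * lam := by rw [ht]; field_simp
  have hs : Real.sqrt ((1 - γ + lam) ^ 2 + 4 * γ * lam) < (1 - γ + lam) + t := by
    rw [Real.sqrt_lt' (by linarith)]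
    nlinarith [mul_pos htp hlam, mul_pos htp htp]
  have h1 : 1 / (1 - γ) = t / (2 * γ * lam) := by
    rw [div_eq_div_iff hd.ne' hp.ne']; linarith
  rw [h1, div_neg, ← neg_div]
  exact div_lt_div_of_pos_right (by linarith) hp
end
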